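/- arXiv:1011.5862 — 2 statements merged into one kernel-verified Lean document; each statement's English description precedes it below -/
import Mathlib

section
/- Let F = F(A) be the free group on A = {a_1,…,a_k} with k ≥ 2, let m ≥ 1, and let 0 < λ < 1. The set of m-tuples (u_1,…,u_m) ∈ C_{m,A} such that the symmetrized closure of {u_1,…,u_m} satisfies the C'(λ)-small cancellation condition is exponentially generic in C_{m,A}. -/
/-!
STATEMENT 10: for k ≥ 2, m ≥ 1, 0 < λ < 1, the set of m-tuples in C_{m,A}
whose symmetrized closure satisfies the C-prime(λ) small cancellation
condition is exponentially generic in C_{m,A}.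
-/

/-- The length of the freely reduced word representing `g`. -/
def wlen {α : Type} [DecidableEq α] (g : FreeGroup α) : ℕ := g.toWord.length

/-- `g` is cyclically reduced: in its reduced word the first letter is not
the inverse of the last letter. -/
def CyclicallyReduced {α : Type} [DecidableEq α] (g : FreeGroup α) : Prop :=
  ∀ x y : α × Bool, g.toWord.head? = some x → g.toWord.getLast? = some y →
    x ≠ (y.1, !y.2)

/-- `C_{m,A}`: the set of `m`-tuples of cyclically reduced words in the free
group of rank `k`, all entries of equal length. -/
def Cset (k m : ℕ) : Set (Fin m → FreeGroup (Fin k)) :=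
  {T | (∀ i, CyclicallyReduced (T i)) ∧ ∀ i j, wlen (T i) = wlen (T j)}

/-- `γ_A(n,U)`: the number of tuples in `U` all of whose entries have length `n`. -/
noncomputable def gammaA {k m : ℕ} (U : Set (Fin m → FreeGroup (Fin k))) (n : ℕ) : ℕ :=
  Set.ncard {T | T ∈ U ∧ ∀ i, wlen (T i) = n}

/-- `U` is an exponentially generic subset of `C_{m,A}`:
`γ(n,U)/γ(n,C_{m,A}) → 1` exponentially fast. -/
def ExpGenericIn {k m : ℕ} (U : Set (Fin m → FreeGroup (Fin k))) : Prop :=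
  U ⊆ Cset k m ∧ ∃ C : ℝ, 0 < C ∧ ∃ q : ℝ, 0 < q ∧ q < 1 ∧
    ∀ n : ℕ, |((gammaA U n : ℝ) / (gammaA (Cset k m) n : ℝ)) - 1| ≤ C * q ^ n

/-- The formal inverse of a word: reverse the word and invert each letter. -/
def wordInv {α : Type} (l : List (α × Bool)) : List (α × Bool) :=
  (l.map fun p => (p.1, !p.2)).reverse

/-- `u` is a (contiguous) subword of `w`. -/
def Subword {α : Type} (u w : List (α × Bool)) : Prop :=
  ∃ s t : List (α × Bool), w = s ++ u ++ t

/-- The symmetrized closure of the entries of a tuple of cyclically reduced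
words: all cyclic permutations of the entries and of their inverses. -/
def symClosure {k m : ℕ} (T : Fin m → FreeGroup (Fin k)) : Set (FreeGroup (Fin k)) :=
  {r | ∃ i : Fin m, ∃ n : ℕ,
    r = FreeGroup.mk (((T i).toWord).rotate n) ∨
    r = FreeGroup.mk ((wordInv ((T i).toWord)).rotate n)}

/-- `v` is a piece with respect to `R`: an initial segment of two distinct
elements of `R`. -/
def IsPiece {α : Type} [DecidableEq α] (R : Set (FreeGroup α)) (v : List (α × Bool)) : Prop :=
  ∃ r₁ ∈ R, ∃ r₂ ∈ R, r₁ ≠ r₂ ∧ v <+: r₁.toWord ∧ v <+: r₂.toWord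

/-- The small cancellation condition C'(λ) for a symmetrized set `R`. -/
def SmallCancelCond {α : Type} [DecidableEq α] (lam : ℝ) (R : Set (FreeGroup α)) : Prop :=
  ∀ v, IsPiece R v → ∀ r ∈ R, Subword v r.toWord →
    (v.length : ℝ) < lam * (r.toWord.length : ℝ)

/-! ### Letters and periodic words -/

/-- inverse letter -/
def linv {α : Type} (a : α × Bool) : α × Bool := (a.1, !a.2)

theorem linv_linv {α : Type} (a : α × Bool) : linv (linv a) = a := by
  simp [linv]

theorem linv_ne {α : Type} (a : α × Bool) : linv a ≠ a := by
  intro h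
  have := congrArg Prod.snd h
  simp [linv] at this

theorem linv_inj {α : Type} {a b : α × Bool} (h : linv a = linv b) : a = b := by
  rw [← linv_linv a, h, linv_linv]

theorem ne_linv_iff {α : Type} (a b : α × Bool) : b ≠ linv a ↔ (a.1 = b.1 → a.2 = b.2) := by
  rcases a with ⟨a, x⟩
  rcases b with ⟨b, y⟩
  simp only [linv, ne_eq, Prod.mk.injEq, not_and]
  cases x <;> cases y <;> simp [eq_comm]

/-- the periodic two-sided infinite word of a list -/
def cw {α : Type} (a0 : α × Bool) (l : List (α × Bool)) (p : ℤ) : α × Bool :=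
  l.getD (p % (l.length : ℤ)).toNat a0

theorem cw_congr {α : Type} (a0 : α × Bool) (l : List (α × Bool)) (p q : ℤ)
    (h : (l.length : ℤ) ∣ p - q) : cw a0 l p = cw a0 l q := by
  have : p % (l.length : ℤ) = q % (l.length : ℤ) := Int.emod_eq_emod_iff_emod_sub_eq_zero.2
    (Int.emod_eq_zero_of_dvd h)
  simp [cw, this]

theorem cw_nat {α : Type} (a0 : α × Bool) (l : List (α × Bool)) (x : ℕ) (h : x < l.length) :
    cw a0 l x = l[x] := by
  have : ((x : ℤ) % (l.length : ℤ)).toNat = x := by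
    rw [Int.emod_eq_of_lt (by omega) (by omega)]; simp
  rw [cw, this, List.getD_eq_getElem _ _ h]

/-- any integer has a representative in a window of length n -/
theorem exists_rep (n : ℕ) (hn : 0 < n) (t p : ℤ) :
    ∃ y : ℕ, y < n ∧ (n : ℤ) ∣ p - (t + y) := by
  refine ⟨((p - t) % n).toNat, ?_, ?_⟩
  · have := Int.emod_lt_of_pos (p - t) (b := n) (by omega)
    have := Int.emod_nonneg (p - t) (b := n) (by omega)
    omega
  · have := Int.emod_nonneg (p - t) (b := n) (by omega)
    rw [Int.toNat_of_nonneg this]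
    have h2 := Int.emod_add_mul_ediv (p - t) n
    exact ⟨(p - t) / n, by linarith⟩

theorem cw_window {α : Type} (a0 : α × Bool) (l l' : List (α × Bool)) (hl : l.length = l'.length)
    (hn : 0 < l.length) (t : ℤ) (h : ∀ y : ℕ, y < l.length → cw a0 l (t + y) = cw a0 l' (t + y))
    (p : ℤ) : cw a0 l p = cw a0 l' p := by
  obtain ⟨y, hy, hd⟩ := exists_rep l.length hn t p
  rw [cw_congr a0 l p _ hd, h y hy, cw_congr a0 l' p _ (hl ▸ hd)]

theorem cw_ext {α : Type} (a0 : α × Bool) (l l' : List (α × Bool)) (hl : l.length = l'.length)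
    (h : ∀ p, cw a0 l p = cw a0 l' p) : l = l' := by
  apply List.ext_getElem hl
  intro i h1 h2
  rw [← cw_nat a0 l i h1, ← cw_nat a0 l' i h2, h]

theorem cw_rotate {α : Type} (a0 : α × Bool) (l : List (α × Bool)) (hn : 0 < l.length) (s : ℕ)
    (p : ℤ) : cw a0 (l.rotate s) p = cw a0 l (s + p) := by
  obtain ⟨y, hy, hd⟩ := exists_rep l.length hn 0 p
  rw [cw_congr a0 (l.rotate s) p y (by simpa using hd),
    cw_congr a0 l (s + p) (((y + s) % l.length : ℕ) : ℤ) ?_,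
    cw_nat _ _ y (by simpa using hy), cw_nat _ _ _ (Nat.mod_lt _ hn), List.getElem_rotate]
  push_cast
  have h2 := Int.emod_add_mul_ediv ((y : ℤ) + s) l.length
  obtain ⟨c, hc⟩ := hd
  exact ⟨c + ((y : ℤ) + s) / l.length, by linarith⟩

theorem length_wordInv {α : Type} (l : List (α × Bool)) : (wordInv l).length = l.length := by
  simp [wordInv]

theorem cw_wordInv {α : Type} (a0 : α × Bool) (l : List (α × Bool)) (hn : 0 < l.length)
    (p : ℤ) : cw a0 (wordInv l) p = linv (cw a0 l (-1 - p)) := by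
  obtain ⟨y, hy, hd⟩ := exists_rep l.length hn 0 p
  rw [cw_congr a0 (wordInv l) p y (by simpa [length_wordInv] using hd),
    cw_congr a0 l (-1 - p) ((l.length - 1 - y : ℕ) : ℤ) ?_,
    cw_nat _ _ y (by simpa [length_wordInv] using hy), cw_nat _ _ _ (by omega)]
  · simp [wordInv, linv]
  obtain ⟨c, hc⟩ := hd
  refine ⟨-1 - c, ?_⟩
  rw [show ((l.length - 1 - y : ℕ) : ℤ) = l.length - 1 - y by omega]
  linarith

/-- cyclic reducedness of the periodic word -/
def GoodW {α : Type} (a0 : α × Bool) (l : List (α × Bool)) : Prop :=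
  ∀ p, cw a0 l (p + 1) ≠ linv (cw a0 l p)

theorem GoodW.reduced {α : Type} {a0 : α × Bool} {l : List (α × Bool)} (h : GoodW a0 l) :
    FreeGroup.IsReduced l := by
  unfold FreeGroup.IsReduced
  rw [List.isChain_iff_getElem]
  intro i hi
  rw [← ne_linv_iff, ← cw_nat a0 l i (by omega), ← cw_nat a0 l (i + 1) hi]
  exact_mod_cast h i

theorem GoodW.rotate {α : Type} {a0 : α × Bool} {l : List (α × Bool)} (h : GoodW a0 l)
    (hn : 0 < l.length) (s : ℕ) : GoodW a0 (l.rotate s) := by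
  intro p
  rw [cw_rotate _ _ hn, cw_rotate _ _ hn, ← add_assoc]
  exact h _

theorem GoodW.inv {α : Type} {a0 : α × Bool} {l : List (α × Bool)} (h : GoodW a0 l)
    (hn : 0 < l.length) : GoodW a0 (wordInv l) := by
  intro p e
  rw [cw_wordInv _ _ hn, cw_wordInv _ _ hn] at e
  have e := linv_inj e
  apply h (-1 - (p + 1))
  rw [e, linv_linv]
  congr 1; ring

theorem goodW_of {α : Type} [DecidableEq α] (a0 : α × Bool) (g : FreeGroup α)
    (hg : CyclicallyReduced g) (hn : 0 < g.toWord.length) : GoodW a0 g.toWord := by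
  intro p
  obtain ⟨y, hy, hd⟩ := exists_rep _ hn 0 p
  rw [zero_add] at hd
  rw [cw_congr a0 _ p y hd, cw_congr a0 _ (p + 1) (y + 1) (by simpa using hd)]
  by_cases h : y + 1 < g.toWord.length
  · have := FreeGroup.isReduced_toWord (x := g)
    unfold FreeGroup.IsReduced at this
    rw [List.isChain_iff_getElem] at this
    have := this y h
    rw [← ne_linv_iff, ← cw_nat a0 _ y (by omega), ← cw_nat a0 _ (y + 1) h] at this
    exact_mod_cast this
  · rw [cw_congr a0 _ (y + 1) (0 : ℕ) ⟨1, by push_cast; omega⟩, cw_nat _ _ _ hn, cw_nat _ _ _ hy]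
    apply hg
    · rw [List.head?_eq_getElem?, List.getElem?_eq_getElem hn]
    · rw [List.getLast?_eq_getElem?, show g.toWord.length - 1 = y by omega,
        List.getElem?_eq_getElem hy]

/-! ### Determination by a window -/

theorem det_same {α : Type} (a0 : α × Bool) (l l' : List (α × Bool)) (n L : ℕ)
    (hl : l.length = n) (hl' : l'.length = n) (hn : 0 < n) (hL : 2 * L ≤ n) (s t d : ℤ)
    (hd0 : 0 < d) (hd : 2 * d ≤ n) (hst : (n : ℤ) ∣ t - s - d)
    (h : ∀ x : ℕ, x < L → cw a0 l (s + x) = cw a0 l (t + x))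
    (h' : ∀ x : ℕ, x < L → cw a0 l' (s + x) = cw a0 l' (t + x))
    (hw : ∀ y : ℕ, y < n - L → cw a0 l (t + L + y) = cw a0 l' (t + L + y)) : l = l' := by
  apply cw_ext a0 l l' (by omega)
  apply cw_window a0 l l' (by omega) (by omega) t
  intro y hy
  rw [hl] at hy
  induction y using Nat.strong_induction_on with
  | _ y ih =>
  by_cases hyL : L ≤ y
  · have := hw (y - L) (by omega)
    rw [show t + L + ((y - L : ℕ) : ℤ) = t + y by omega] at this
    exact this
  push Not at hyL
  rw [← h y hyL, ← h' y hyL]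
  subst hl
  obtain ⟨c, hc⟩ := hst
  rw [cw_congr a0 l (s + y) (t + (y - d)) ⟨-c, by linarith⟩,
    cw_congr a0 l' (s + y) (t + (y - d)) ⟨-c, by rw [hl']; linarith⟩]
  by_cases hyd : d ≤ y
  · have := ih (y - d).toNat (by omega) (by omega)
    rwa [Int.toNat_of_nonneg (by omega)] at this
  · have := hw (y - d + l.length - L).toNat (by omega)
    rw [Int.toNat_of_nonneg (by omega)] at this
    rw [cw_congr a0 l (t + (y - d)) (t + L + (y - d + l.length - L)) ⟨-1, by ring⟩,
    cw_congr a0 l' (t + (y - d)) (t + L + (y - d + l.length - L)) ⟨-1, by rw [hl']; ring⟩]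
    exact this

theorem det_diff {α : Type} (a0 : α × Bool) (w l l' : List (α × Bool)) (n L : ℕ)
    (hl : l.length = n) (hl' : l'.length = n) (hn : 0 < n) (s t : ℤ)
    (h : ∀ x : ℕ, x < L → cw a0 w (s + x) = cw a0 l (t + x))
    (h' : ∀ x : ℕ, x < L → cw a0 w (s + x) = cw a0 l' (t + x))
    (hw : ∀ y : ℕ, y < n - L → cw a0 l (t + L + y) = cw a0 l' (t + L + y)) : l = l' := by
  apply cw_ext a0 l l' (by omega)
  apply cw_window a0 l l' (by omega) (by omega) t
  intro y hy
  by_cases hyL : L ≤ y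
  · have := hw (y - L) (by omega)
    rw [show t + L + ((y - L : ℕ) : ℤ) = t + y by omega] at this
    exact this
  push Not at hyL
  rw [← h y hyL, ← h' y hyL]

theorem no_mid {α : Type} (a0 : α × Bool) (l : List (α × Bool)) (n L : ℕ) (hg : GoodW a0 l)
    (hl : l.length = n) (s t : ℤ)
    (h : ∀ x : ℕ, x < L → cw a0 l (s + x) = linv (cw a0 l (t - x)))
    (x y : ℕ) (hx : x < L) (hy : y < L) (hxy : (n : ℤ) ∣ (s + x) - (t - y)) : False := by
  subst hl
  obtain ⟨c, hc⟩ := hxy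
  have hm := h ((x + y) / 2) (by omega)
  rcases Nat.even_or_odd' (x + y) with ⟨z, hz | hz⟩
  · rw [show (x + y) / 2 = z by omega] at hm
    rw [cw_congr a0 l (t - z) (s + z) ⟨-c, by have : (x : ℤ) + y = 2 * z := by exact_mod_cast hz
                                              linarith⟩] at hm
    exact linv_ne _ hm.symm
  · rw [show (x + y) / 2 = z by omega] at hm
    rw [cw_congr a0 l (t - z) (s + z + 1) ⟨-c, by
      have : (x : ℤ) + y = 2 * z + 1 := by exact_mod_cast hz
      linarith⟩] at hm
    apply hg (s + z)
    rw [hm, linv_linv]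

theorem det_opp {α : Type} (a0 : α × Bool) (l l' : List (α × Bool)) (n L : ℕ)
    (hg : GoodW a0 l)
    (hl : l.length = n) (hl' : l'.length = n) (hn : 0 < n) (hL : L ≤ n) (s t : ℤ)
    (h : ∀ x : ℕ, x < L → cw a0 l (s + x) = linv (cw a0 l (t - x)))
    (h' : ∀ x : ℕ, x < L → cw a0 l' (s + x) = linv (cw a0 l' (t - x)))
    (hw : ∀ y : ℕ, y < n - L → cw a0 l (t + 1 + y) = cw a0 l' (t + 1 + y)) : l = l' := by
  apply cw_ext a0 l l' (by omega)
  apply cw_window a0 l l' (by omega) (by omega) (t + 1)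
  intro y hy
  rw [hl] at hy
  by_cases hyL : y < n - L
  · exact hw y hyL
  push Not at hyL
  -- position t + 1 + y ≡ t - x, x = n - 1 - y
  have hx : n - 1 - y < L := by omega
  rw [cw_congr a0 l (t + 1 + y) (t - (n - 1 - y : ℕ)) ⟨1, by rw [hl]; omega⟩,
    cw_congr a0 l' (t + 1 + y) (t - (n - 1 - y : ℕ)) ⟨1, by rw [hl']; omega⟩]
  apply linv_inj
  rw [← h _ hx, ← h' _ hx]
  obtain ⟨z, hz, hd⟩ := exists_rep n hn (t + 1) (s + (n - 1 - y : ℕ))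
  rw [cw_congr a0 l _ (t + 1 + z) (by rw [hl]; exact hd),
    cw_congr a0 l' _ (t + 1 + z) (by rw [hl']; exact hd)]
  by_cases hzL : z < n - L
  · exact hw z hzL
  exfalso
  refine no_mid a0 l n L hg hl s t h _ (n - 1 - z) hx (by omega) ?_
  obtain ⟨c, hc⟩ := hd
  refine ⟨c + 1, ?_⟩
  rw [show ((n - 1 - z : ℕ) : ℤ) = n - 1 - z by omega]
  linarith

theorem det_opp_diff {α : Type} (a0 : α × Bool) (w l l' : List (α × Bool)) (n L : ℕ)
    (hl : l.length = n) (hl' : l'.length = n) (hn : 0 < n) (s t : ℤ)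
    (h : ∀ x : ℕ, x < L → cw a0 w (s + x) = linv (cw a0 l (t - x)))
    (h' : ∀ x : ℕ, x < L → cw a0 w (s + x) = linv (cw a0 l' (t - x)))
    (hw : ∀ y : ℕ, y < n - L → cw a0 l (t + 1 + y) = cw a0 l' (t + 1 + y)) : l = l' := by
  apply cw_ext a0 l l' (by omega)
  apply cw_window a0 l l' (by omega) (by omega) (t + 1)
  intro y hy
  rw [hl] at hy
  by_cases hyL : y < n - L
  · exact hw y hyL
  push Not at hyL
  have hx : n - 1 - y < L := by omega
  rw [cw_congr a0 l (t + 1 + y) (t - (n - 1 - y : ℕ)) ⟨1, by rw [hl]; omega⟩,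
    cw_congr a0 l' (t + 1 + y) (t - (n - 1 - y : ℕ)) ⟨1, by rw [hl']; omega⟩]
  apply linv_inj
  rw [← h _ hx, ← h' _ hx]

def BadA {k m : ℕ} (a0 : Fin k × Bool) (n L : ℕ) (T : Fin m → FreeGroup (Fin k)) (i j : Fin m)
    (s t : ℤ) : Prop :=
  (i = j → ∃ d : ℤ, 0 < d ∧ 2 * d ≤ n ∧ (n : ℤ) ∣ t - s - d) ∧
    ∀ x : ℕ, x < L → cw a0 (T i).toWord (s + x) = cw a0 (T j).toWord (t + x)

/-- one entry and the inverse of another share a cyclic subword of length `L` -/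
def BadB {k m : ℕ} (a0 : Fin k × Bool) (L : ℕ) (T : Fin m → FreeGroup (Fin k)) (i j : Fin m)
    (s t : ℤ) : Prop :=
  ∀ x : ℕ, x < L → cw a0 (T i).toWord (s + x) = linv (cw a0 (T j).toWord (t - x))

theorem sym_rep {k m : ℕ} (a0 : Fin k × Bool) (n : ℕ) (hn : 0 < n)
    (T : Fin m → FreeGroup (Fin k)) (hT : ∀ i, CyclicallyReduced (T i))
    (hlen : ∀ i, wlen (T i) = n) (r : FreeGroup (Fin k)) (hr : r ∈ symClosure T) :
    r.toWord.length = n ∧ ∃ i : Fin m, ∃ s : ℤ,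
      (∀ p, cw a0 r.toWord p = cw a0 (T i).toWord (s + p)) ∨
      (∀ p, cw a0 r.toWord p = linv (cw a0 (T i).toWord (s - p))) := by
  obtain ⟨i, s, h⟩ := hr
  have hli : (T i).toWord.length = n := hlen i
  have hpos : 0 < (T i).toWord.length := by omega
  have hg := goodW_of a0 (T i) (hT i) hpos
  rcases h with rfl | rfl
  · have e : (FreeGroup.mk ((T i).toWord.rotate s)).toWord = (T i).toWord.rotate s := by
      rw [FreeGroup.toWord_mk]
      exact (hg.rotate hpos s).reduced.reduce_eq
    rw [e]
    refine ⟨by simpa using hli, i, s, Or.inl fun p => cw_rotate _ _ hpos _ _⟩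
  · have hpos' : 0 < (wordInv (T i).toWord).length := by rw [length_wordInv]; exact hpos
    have e : (FreeGroup.mk ((wordInv (T i).toWord).rotate s)).toWord
        = (wordInv (T i).toWord).rotate s := by
      rw [FreeGroup.toWord_mk]
      exact ((hg.inv hpos).rotate hpos' s).reduced.reduce_eq
    rw [e]
    refine ⟨by simpa [length_wordInv] using hli, i, -1 - s, Or.inr fun p => ?_⟩
    rw [cw_rotate _ _ hpos', cw_wordInv _ _ hpos]
    congr 2; ring

theorem badA_of {k m : ℕ} (a0 : Fin k × Bool) (n L : ℕ) (hn : 0 < n)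
    (T : Fin m → FreeGroup (Fin k)) (i j : Fin m) (s t : ℤ)
    (h : ∀ x : ℕ, x < L → cw a0 (T i).toWord (s + x) = cw a0 (T j).toWord (t + x))
    (hne : i = j → ¬ (n : ℤ) ∣ t - s) :
    ∃ i j s t, BadA a0 n L T i j s t := by
  by_cases hij : i = j
  · subst hij
    have h0 := Int.emod_nonneg (t - s) (b := n) (by omega)
    have h1 := Int.emod_lt_of_pos (t - s) (b := n) (by omega)
    have h2 : (t - s) % n ≠ 0 := fun h => hne rfl (Int.dvd_of_emod_eq_zero h)
    have h3 := Int.emod_add_mul_ediv (t - s) n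
    by_cases hd : 2 * ((t - s) % n) ≤ n
    · exact ⟨i, i, s, t, fun _ => ⟨(t - s) % n, by omega, hd, (t - s) / n, by linarith⟩, h⟩
    · exact ⟨i, i, t, s, fun _ => ⟨n - (t - s) % n, by omega, by omega,
        -((t - s) / n) - 1, by linarith⟩, fun x hx => (h x hx).symm⟩
  · exact ⟨i, j, s, t, fun e => absurd e hij, h⟩

theorem bad_extract {k m : ℕ} (a0 : Fin k × Bool) (n L : ℕ) (hn : 0 < n)
    (T : Fin m → FreeGroup (Fin k)) (hT : ∀ i, CyclicallyReduced (T i))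
    (hlen : ∀ i, wlen (T i) = n) (lam : ℝ) (hL : (L : ℝ) ≤ lam * n)
    (hbad : ¬ SmallCancelCond lam (symClosure T)) :
    ∃ i j s t, BadA a0 n L T i j s t ∨ BadB a0 L T i j s t := by
  unfold SmallCancelCond at hbad
  push Not at hbad
  obtain ⟨v, ⟨r1, hr1, r2, hr2, hne, hp1, hp2⟩, r, hr, -, hv⟩ := hbad
  obtain ⟨hrl, -⟩ := sym_rep a0 n hn T hT hlen r hr
  rw [hrl] at hv
  have hLv : L ≤ v.length := by exact_mod_cast hL.trans hv
  obtain ⟨hl1, i, s, h1⟩ := sym_rep a0 n hn T hT hlen r1 hr1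
  obtain ⟨hl2, j, t, h2⟩ := sym_rep a0 n hn T hT hlen r2 hr2
  have key : ∀ x : ℕ, x < L → cw a0 r1.toWord x = cw a0 r2.toWord x := by
    intro x hx
    have b1 := hp1.length_le
    have b2 := hp2.length_le
    rw [cw_nat _ _ x (by omega), cw_nat _ _ x (by omega), ← hp1.getElem (by omega),
      ← hp2.getElem (by omega)]
  have hne' : ¬ ∀ p, cw a0 r1.toWord p = cw a0 r2.toWord p := fun h =>
    hne (FreeGroup.toWord_injective (cw_ext a0 _ _ (by omega) h))
  rcases h1 with h1 | h1 <;> rcases h2 with h2 | h2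
  · obtain ⟨i, j, s, t, h⟩ := badA_of a0 n L hn T i j s t
      (fun x hx => by rw [← h1, ← h2, key x hx]) (by
        rintro rfl ⟨c, hc⟩
        apply hne'
        intro p
        rw [h1, h2]
        apply cw_congr
        rw [show (T i).toWord.length = n from hlen i]
        exact ⟨-c, by linarith⟩)
    exact ⟨i, j, s, t, Or.inl h⟩
  · refine ⟨i, j, s, t, Or.inr fun x hx => ?_⟩
    rw [← h1, ← h2, key x hx]
  · refine ⟨j, i, t, s, Or.inr fun x hx => ?_⟩
    rw [← h1, ← h2, key x hx]
  · obtain ⟨i, j, s, t, h⟩ := badA_of a0 n L hn T i j (s - L + 1) (t - L + 1)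
      (fun x hx => by
        have := key (L - 1 - x) (by omega)
        rw [h1, h2] at this
        have := linv_inj this
        rw [show ((L - 1 - x : ℕ) : ℤ) = L - 1 - x by omega] at this
        convert this using 2 <;> ring) (by
        rintro rfl ⟨c, hc⟩
        apply hne'
        intro p
        rw [h1, h2]
        congr 1
        apply cw_congr
        rw [show (T i).toWord.length = n from hlen i]
        exact ⟨-c, by linarith⟩)
    exact ⟨i, j, s, t, Or.inl h⟩

theorem bad_extract_fin {k m : ℕ} (a0 : Fin k × Bool) (n L : ℕ) (hn : 0 < n)
    (T : Fin m → FreeGroup (Fin k)) (hT : ∀ i, CyclicallyReduced (T i))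
    (hlen : ∀ i, wlen (T i) = n) (lam : ℝ) (hL : (L : ℝ) ≤ lam * n)
    (hbad : ¬ SmallCancelCond lam (symClosure T)) :
    ∃ i j : Fin m, ∃ s t : Fin n,
      BadA a0 n L T i j (s : ℕ) (t : ℕ) ∨ BadB a0 L T i j (s : ℕ) (t : ℕ) := by
  obtain ⟨i, j, s, t, h⟩ := bad_extract a0 n L hn T hT hlen lam hL hbad
  obtain ⟨s', hs', hs⟩ := exists_rep n hn 0 s
  obtain ⟨t', ht', ht⟩ := exists_rep n hn 0 t
  rw [zero_add] at hs ht
  have es : ∀ x : ℤ, cw a0 (T i).toWord (s + x) = cw a0 (T i).toWord (s' + x) := fun x =>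
    cw_congr _ _ _ _ (by rw [show (T i).toWord.length = n from hlen i]; simpa using hs)
  have et : ∀ x : ℤ, cw a0 (T j).toWord (t + x) = cw a0 (T j).toWord (t' + x) := fun x =>
    cw_congr _ _ _ _ (by rw [show (T j).toWord.length = n from hlen j]; simpa using ht)
  refine ⟨i, j, ⟨s', hs'⟩, ⟨t', ht'⟩, ?_⟩
  rcases h with ⟨h1, h2⟩ | h
  · left
    refine ⟨fun e => ?_, fun x hx => ?_⟩
    · obtain ⟨d, h3, h4, c, hc⟩ := h1 e
      obtain ⟨a, ha⟩ := hs
      obtain ⟨b, hb⟩ := ht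
      exact ⟨d, h3, h4, c + a - b, by simp only []; linarith⟩
    · simpa only [es, et] using h2 x hx
  · right
    intro x hx
    have := h x hx
    simpa only [es, sub_eq_add_neg, et] using this

/-! ### Counting reduced words -/

/-- reduced words of length `p` that may follow the letter `a` -/
def RW {k : ℕ} : Fin k × Bool → ℕ → Finset (List (Fin k × Bool))
  | _, 0 => {[]}
  | a, p + 1 => (Finset.univ.filter (fun x => x ≠ linv a)).biUnion
      fun x => (RW x p).image (List.cons x)

theorem card_RW {k : ℕ} (p : ℕ) : ∀ a : Fin k × Bool, (RW a p).card = (2 * k - 1) ^ p := by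
  induction p with
  | zero => intro a; simp [RW]
  | succ p ih =>
    intro a
    rw [RW, Finset.card_biUnion]
    · rw [Finset.sum_congr rfl (g := fun _ => (2 * k - 1) ^ p)]
      · rw [Finset.sum_const, Finset.filter_ne', Finset.card_erase_of_mem (Finset.mem_univ _),
          Finset.card_univ, Fintype.card_prod, Fintype.card_fin, Fintype.card_bool, smul_eq_mul,
          pow_succ, mul_comm k 2, mul_comm]
      · intro x _
        rw [Finset.card_image_of_injective _ (List.cons_injective), ih]
    · intro x _ y _ hxy
      rw [Function.onFun, Finset.disjoint_left]
      intro l hl hl'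
      simp only [Finset.mem_image] at hl hl'
      obtain ⟨_, _, rfl⟩ := hl
      obtain ⟨_, _, h⟩ := hl'
      exact hxy (List.cons.inj h).1.symm

theorem mem_RW {k : ℕ} (p : ℕ) : ∀ (a : Fin k × Bool) (l : List (Fin k × Bool)),
    l ∈ RW a p ↔ l.length = p ∧ FreeGroup.IsReduced (a :: l) := by
  induction p with
  | zero =>
    intro a l
    simp only [RW, Finset.mem_singleton, List.length_eq_zero_iff]
    constructor
    · rintro rfl; exact ⟨rfl, FreeGroup.IsReduced.singleton⟩
    · exact fun h => h.1
  | succ p ih =>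
    intro a l
    simp only [RW, Finset.mem_biUnion, Finset.mem_filter, Finset.mem_univ, true_and,
      Finset.mem_image, ih]
    constructor
    · rintro ⟨x, hx, l', ⟨h1, h2⟩, rfl⟩
      refine ⟨by simp [h1], ?_⟩
      rw [FreeGroup.isReduced_cons_cons, ← ne_linv_iff]
      exact ⟨hx, h2⟩
    · rintro ⟨h1, h2⟩
      match l, h1, h2 with
      | x :: l', h1, h2 =>
        rw [FreeGroup.isReduced_cons_cons, ← ne_linv_iff] at h2
        exact ⟨x, h2.1, l', ⟨by simpa using h1, h2.2⟩, rfl⟩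

/-- a finset containing all reduced words of length `p` -/
def RA (k p : ℕ) : Finset (List (Fin k × Bool)) := Finset.univ.biUnion fun a => RW a p

theorem card_RA (k p : ℕ) : (RA k p).card ≤ 2 * k * (2 * k - 1) ^ p := by
  refine Finset.card_biUnion_le.trans ?_
  simp [card_RW, mul_comm]

theorem mem_RA {k p : ℕ} (a0 : Fin k × Bool) (l : List (Fin k × Bool)) (hl : l.length = p)
    (h : FreeGroup.IsReduced l) : l ∈ RA k p := by
  simp only [RA, Finset.mem_biUnion, Finset.mem_univ, true_and, mem_RW]
  match l, hl, h with
  | [], hl, h => exact ⟨a0, hl, FreeGroup.IsReduced.singleton⟩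
  | x :: l', hl, h => exact ⟨x, hl, FreeGroup.isReduced_cons_cons.2 ⟨fun _ => rfl, h⟩⟩

theorem finite_SN (k n : ℕ) : {g : FreeGroup (Fin k) | CyclicallyReduced g ∧ wlen g = n}.Finite := by
  apply Set.Finite.of_finite_image (f := FreeGroup.toWord)
  · apply (List.finite_length_eq (Fin k × Bool) n).subset
    rintro _ ⟨g, hg, rfl⟩
    exact hg.2
  · exact FreeGroup.toWord_injective.injOn

/-- cyclically reduced words of length `n` -/
noncomputable def SN (k n : ℕ) : Finset (FreeGroup (Fin k)) := (finite_SN k n).toFinset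

theorem mem_SN {k n : ℕ} (g : FreeGroup (Fin k)) :
    g ∈ SN k n ↔ CyclicallyReduced g ∧ wlen g = n := by
  simp [SN]

theorem exists_letter {k : ℕ} (hk : 2 ≤ k) (u v : Fin k × Bool) : ∃ b, b ≠ u ∧ b ≠ v := by
  have : ({u, v} : Finset (Fin k × Bool)).card < (Finset.univ : Finset (Fin k × Bool)).card := by
    refine (Finset.card_le_two).trans_lt ?_
    rw [Finset.card_univ, Fintype.card_prod, Fintype.card_fin, Fintype.card_bool]
    omega
  obtain ⟨b, -, hb⟩ := Finset.exists_mem_notMem_of_card_lt_card this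
  simp only [Finset.mem_insert, Finset.mem_singleton, not_or] at hb
  exact ⟨b, hb⟩

theorem card_SN {k : ℕ} (hk : 2 ≤ k) (p : ℕ) : (2 * k - 1) ^ p ≤ (SN k (p + 2)).card := by
  let a : Fin k × Bool := (⟨0, by omega⟩, true)
  choose b hb1 hb2 using fun l : List (Fin k × Bool) =>
    exists_letter hk (linv a) (linv ((a :: l).getLast (by simp)))
  have red : ∀ l, FreeGroup.IsReduced (a :: l) → FreeGroup.IsReduced ((a :: l) ++ [b l]) := by
    intro l hl
    unfold FreeGroup.IsReduced at *
    rw [List.isChain_append]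
    refine ⟨hl, List.isChain_singleton _, ?_⟩
    intro x hx y hy
    rw [← ne_linv_iff]
    simp only [List.head?_cons, Option.mem_def, Option.some.injEq] at hy
    subst hy
    rw [Option.mem_def, List.getLast?_eq_some_getLast (by simp), Option.some.injEq] at hx
    subst hx
    exact hb2 l
  have tw : ∀ l ∈ RW a p, (FreeGroup.mk ((a :: l) ++ [b l])).toWord = (a :: l) ++ [b l] := by
    intro l hl
    rw [FreeGroup.toWord_mk]
    exact (red l ((mem_RW p a l).1 hl).2).reduce_eq
  rw [← card_RW p a]
  apply Finset.card_le_card_of_injOn (fun l => FreeGroup.mk ((a :: l) ++ [b l]))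
  · intro l hl
    have hl := Finset.mem_coe.1 hl
    rw [Finset.mem_coe, mem_SN]
    refine ⟨?_, ?_⟩
    · intro x y hx hy
      rw [tw l hl] at hx hy
      simp only [List.cons_append, List.head?_cons, Option.some.injEq] at hx
      rw [List.getLast?_concat, Option.some.injEq] at hy
      subst hx hy
      intro h
      apply hb1 l
      rw [h]
      simp [linv]
    · rw [wlen, tw l hl]
      simp [((mem_RW p a l).1 hl).1]
  · intro l hl l' hl' h
    have h : FreeGroup.mk ((a :: l) ++ [b l]) = FreeGroup.mk ((a :: l') ++ [b l']) := h
    have := congrArg FreeGroup.toWord h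
    rw [tw l hl, tw l' hl'] at this
    have h2 := List.append_inj_left' this rfl
    exact (List.cons.inj h2).2

/-! ### Counting bad tuples -/

open Classical in
theorem card_of_window {k m : ℕ} (a0 : Fin k × Bool) (n q : ℕ) (hn : 0 < n)
    (B : Finset (Fin m → FreeGroup (Fin k))) (j : Fin m) (t : ℤ)
    (hB : ∀ T ∈ B, ∀ i, T i ∈ SN k n)
    (hdet : ∀ T ∈ B, ∀ T' ∈ B, (∀ i, i ≠ j → T i = T' i) →
      (∀ y : ℕ, y < q → cw a0 (T j).toWord (t + y) = cw a0 (T' j).toWord (t + y)) →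
      T j = T' j) :
    B.card ≤ (SN k n).card ^ (m - 1) * (2 * k * (2 * k - 1) ^ q) := by
  let tgt : Finset (({i : Fin m // i ≠ j} → FreeGroup (Fin k)) × List (Fin k × Bool)) :=
    (Fintype.piFinset fun _ => SN k n) ×ˢ RA k q
  have hc : tgt.card ≤ (SN k n).card ^ (m - 1) * (2 * k * (2 * k - 1) ^ q) := by
    rw [Finset.card_product, Fintype.card_piFinset]
    simp only [Finset.prod_const, Finset.card_univ]
    rw [Fintype.card_subtype_compl, Fintype.card_fin, Fintype.card_subtype_eq]
    exact Nat.mul_le_mul_left _ (card_RA k q)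
  refine le_trans ?_ hc
  apply Finset.card_le_card_of_injOn
    (fun T => (fun i => T i.1, (List.range q).map fun y : ℕ => cw a0 (T j).toWord (t + y)))
  · intro T hT
    have hT := hB T (Finset.mem_coe.1 hT)
    simp only [tgt, Finset.coe_product, Set.mem_prod, Finset.mem_coe, Fintype.mem_piFinset]
    refine ⟨fun i => hT i, ?_⟩
    apply mem_RA a0 _ (by simp)
    unfold FreeGroup.IsReduced
    rw [List.isChain_iff_getElem]
    intro y hy
    obtain ⟨h1, h2⟩ := (mem_SN _).1 (hT j)
    have hg := goodW_of a0 (T j) h1 (by rw [show (T j).toWord.length = n from h2]; exact hn)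
    rw [← ne_linv_iff]
    have := hg (t + y)
    simpa [add_assoc] using this
  · intro T hT T' hT' h
    simp only [Prod.mk.injEq] at h
    obtain ⟨h1, h2⟩ := h
    have h1' : ∀ i, i ≠ j → T i = T' i := fun i hi => congrFun h1 ⟨i, hi⟩
    have h3 := hdet T hT T' hT' h1' (fun y hy => List.map_inj_left.1 h2 y (List.mem_range.2 hy))
    funext i
    by_cases hi : i = j
    · subst hi; exact h3
    · exact h1' i hi

open Classical in
theorem card_badA {k m : ℕ} (a0 : Fin k × Bool) (n L : ℕ) (hn : 0 < n) (hL : 2 * L ≤ n)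
    (i j : Fin m) (s t : ℤ) :
    ((Fintype.piFinset fun _ : Fin m => SN k n).filter fun T => BadA a0 n L T i j s t).card
      ≤ (SN k n).card ^ (m - 1) * (2 * k * (2 * k - 1) ^ (n - L)) := by
  apply card_of_window a0 n (n - L) hn _ j (t + L)
  · intro T hT
    exact Fintype.mem_piFinset.1 (Finset.mem_filter.1 hT).1
  · intro T hT T' hT' hij hw
    obtain ⟨h1, h2, h3⟩ := Finset.mem_filter.1 hT
    obtain ⟨h1', h2', h3'⟩ := Finset.mem_filter.1 hT'
    have hl : (T j).toWord.length = n := ((mem_SN _).1 (Fintype.mem_piFinset.1 h1 j)).2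
    have hl' : (T' j).toWord.length = n := ((mem_SN _).1 (Fintype.mem_piFinset.1 h1' j)).2
    apply FreeGroup.toWord_injective
    by_cases e : i = j
    · subst e
      obtain ⟨d, hd0, hd1, hd2⟩ := h2 rfl
      exact det_same a0 _ _ n L hl hl' hn hL s t d hd0 hd1 hd2 h3 h3' hw
    · rw [← hij i e] at h3'
      exact det_diff a0 _ _ _ n L hl hl' hn s t h3 h3' hw

open Classical in
theorem card_badB {k m : ℕ} (a0 : Fin k × Bool) (n L : ℕ) (hn : 0 < n) (hL : 2 * L ≤ n)
    (i j : Fin m) (s t : ℤ) :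
    ((Fintype.piFinset fun _ : Fin m => SN k n).filter fun T => BadB a0 L T i j s t).card
      ≤ (SN k n).card ^ (m - 1) * (2 * k * (2 * k - 1) ^ (n - L)) := by
  apply card_of_window a0 n (n - L) hn _ j (t + 1)
  · intro T hT
    exact Fintype.mem_piFinset.1 (Finset.mem_filter.1 hT).1
  · intro T hT T' hT' hij hw
    obtain ⟨h1, h3⟩ := Finset.mem_filter.1 hT
    obtain ⟨h1', h3'⟩ := Finset.mem_filter.1 hT'
    have hs := (mem_SN _).1 (Fintype.mem_piFinset.1 h1 j)
    have hl : (T j).toWord.length = n := hs.2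
    have hl' : (T' j).toWord.length = n := ((mem_SN _).1 (Fintype.mem_piFinset.1 h1' j)).2
    apply FreeGroup.toWord_injective
    by_cases e : i = j
    · subst e
      exact det_opp a0 _ _ n L (goodW_of a0 _ hs.1 (by omega)) hl hl' hn (by omega) s t h3 h3' hw
    · unfold BadB at h3'
      rw [← hij i e] at h3'
      exact det_opp_diff a0 _ _ _ n L hl hl' hn s t h3 h3' hw

open Classical in
theorem card_bad {k m : ℕ} (a0 : Fin k × Bool) (n L : ℕ) (hn : 0 < n) (hL : 2 * L ≤ n)
    (lam : ℝ) (hlam : (L : ℝ) ≤ lam * n) :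
    ((Fintype.piFinset fun _ : Fin m => SN k n).filter
      fun T => ¬ SmallCancelCond lam (symClosure T)).card
      ≤ 2 * m ^ 2 * n ^ 2 * ((SN k n).card ^ (m - 1) * (2 * k * (2 * k - 1) ^ (n - L))) := by
  set M := (SN k n).card ^ (m - 1) * (2 * k * (2 * k - 1) ^ (n - L)) with hM
  let P := Fintype.piFinset fun _ : Fin m => SN k n
  let I : Finset (Fin m × Fin m × Fin n × Fin n) := Finset.univ
  have hsub : P.filter (fun T => ¬ SmallCancelCond lam (symClosure T)) ⊆
      I.biUnion fun x => P.filter (fun T => BadA a0 n L T x.1 x.2.1 (x.2.2.1 : ℕ) (x.2.2.2 : ℕ)) ∪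
        P.filter (fun T => BadB a0 L T x.1 x.2.1 (x.2.2.1 : ℕ) (x.2.2.2 : ℕ)) := by
    intro T hT
    obtain ⟨h1, h2⟩ := Finset.mem_filter.1 hT
    have h3 := fun i => (mem_SN _).1 (Fintype.mem_piFinset.1 h1 i)
    obtain ⟨i, j, s, t, h⟩ := bad_extract_fin a0 n L hn T (fun i => (h3 i).1) (fun i => (h3 i).2)
      lam hlam h2
    refine Finset.mem_biUnion.2 ⟨(i, j, s, t), Finset.mem_univ _, ?_⟩
    rw [Finset.mem_union, Finset.mem_filter, Finset.mem_filter]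
    exact h.imp (fun h => ⟨h1, h⟩) (fun h => ⟨h1, h⟩)
  refine (Finset.card_le_card hsub).trans ?_
  refine (Finset.card_biUnion_le_card_mul _ _ (2 * M) ?_).trans ?_
  · intro x _
    refine (Finset.card_union_le _ _).trans ?_
    have h1 := card_badA a0 n L hn hL x.1 x.2.1 ((x.2.2.1 : ℕ) : ℤ) ((x.2.2.2 : ℕ) : ℤ)
    have h2 := card_badB a0 n L hn hL x.1 x.2.1 ((x.2.2.1 : ℕ) : ℤ) ((x.2.2.2 : ℕ) : ℤ)
    rw [two_mul]
    exact add_le_add h1 h2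
  · simp only [I, Finset.card_univ, Fintype.card_prod, Fintype.card_fin]
    apply le_of_eq; ring

theorem Cset_level {k m n : ℕ} :
    {T : Fin m → FreeGroup (Fin k) | T ∈ Cset k m ∧ ∀ i, wlen (T i) = n} =
      ↑(Fintype.piFinset fun _ : Fin m => SN k n) := by
  ext T
  simp only [Cset, Set.mem_ofPred_eq, Finset.mem_coe, Fintype.mem_piFinset, mem_SN]
  constructor
  · rintro ⟨⟨h1, -⟩, h2⟩ i
    exact ⟨h1 i, h2 i⟩
  · intro h
    exact ⟨⟨fun i => (h i).1, fun i j => by rw [(h i).2, (h j).2]⟩, fun i => (h i).2⟩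

open Classical in
theorem U_level {k m n : ℕ} (lam : ℝ) :
    {T : Fin m → FreeGroup (Fin k) | T ∈ {T : Fin m → FreeGroup (Fin k) | T ∈ Cset k m ∧
      SmallCancelCond lam (symClosure T)} ∧ ∀ i, wlen (T i) = n} =
      ↑((Fintype.piFinset fun _ : Fin m => SN k n).filter
        fun T => SmallCancelCond lam (symClosure T)) := by
  rw [Finset.coe_filter]
  ext T
  have := Set.ext_iff.1 (Cset_level (k := k) (m := m) (n := n)) T
  simp only [Set.mem_ofPred_eq, Finset.mem_coe] at this ⊢
  rw [← this]
  tauto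

theorem ratio_bound {k m : ℕ} (hk : 2 ≤ k) (hm : 1 ≤ m) (lam : ℝ) (n L : ℕ) (hn : 2 ≤ n)
    (hL : 2 * L ≤ n) (hlam : (L : ℝ) ≤ lam * n) :
    |((gammaA {T : Fin m → FreeGroup (Fin k) | T ∈ Cset k m ∧
      SmallCancelCond lam (symClosure T)} n : ℝ) / (gammaA (Cset k m) n : ℝ)) - 1| ≤
      4 * k * m ^ 2 * n ^ 2 * (2 * k - 1) ^ 2 / (2 * k - 1) ^ L := by
  classical
  let a0 : Fin k × Bool := (⟨0, by omega⟩, true)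
  unfold gammaA
  rw [Cset_level, U_level, Set.ncard_coe_finset, Set.ncard_coe_finset]
  have hb := card_bad (m := m) a0 n L (by omega) hL lam hlam
  have hs := Finset.card_filter_add_card_filter_not (s := Fintype.piFinset fun _ : Fin m => SN k n)
    (fun T => SmallCancelCond lam (symClosure T))
  have hP : (Fintype.piFinset fun _ : Fin m => SN k n).card
      = (SN k n).card ^ (m - 1) * (SN k n).card := by
    rw [Fintype.card_piFinset, ← pow_succ]
    simp [show m - 1 + 1 = m by omega]
  have hN := card_SN hk (n - 2)
  rw [show n - 2 + 2 = n by omega] at hN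
  set bad := ((Fintype.piFinset fun _ : Fin m => SN k n).filter
      fun T => ¬ SmallCancelCond lam (symClosure T)).card
  set good := ((Fintype.piFinset fun _ : Fin m => SN k n).filter
      fun T => SmallCancelCond lam (symClosure T)).card
  set P := (Fintype.piFinset fun _ : Fin m => SN k n).card
  set N := (SN k n).card
  have hDn : ((2 * k - 1 : ℕ) : ℝ) = 2 * k - 1 := by
    rw [Nat.cast_sub (by omega)]; push_cast; ring
  have hDpos : (0 : ℝ) < 2 * k - 1 := by
    have : (2 : ℝ) ≤ k := by exact_mod_cast hk
    linarith
  have hN' : ((2 : ℝ) * k - 1) ^ (n - 2) ≤ N := by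
    rw [← hDn]; exact_mod_cast hN
  have hNpos : (0 : ℝ) < N := lt_of_lt_of_le (by positivity) hN'
  have hP' : (P : ℝ) = (N : ℝ) ^ (m - 1) * N := by exact_mod_cast hP
  have hPpos : (0 : ℝ) < P := by rw [hP']; positivity
  have hs' : (good : ℝ) + bad = P := by exact_mod_cast hs
  have hb' : (bad : ℝ) ≤ 2 * m ^ 2 * n ^ 2 *
      ((N : ℝ) ^ (m - 1) * (2 * k * (2 * k - 1) ^ (n - L))) := by
    rw [← hDn]; exact_mod_cast hb
  have e : (good : ℝ) / P - 1 = -(bad / P) := by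
    field_simp; linarith
  rw [e, abs_neg, abs_of_nonneg (by positivity), div_le_div_iff₀ hPpos (by positivity), hP']
  have e2 : ((2 : ℝ) * k - 1) ^ (n - L) * (2 * k - 1) ^ L
      = (2 * k - 1) ^ (n - 2) * (2 * k - 1) ^ 2 := by
    rw [← pow_add, ← pow_add]; congr 1; omega
  calc (bad : ℝ) * (2 * k - 1) ^ L ≤ (2 * m ^ 2 * n ^ 2 *
      ((N : ℝ) ^ (m - 1) * (2 * k * (2 * k - 1) ^ (n - L)))) * (2 * k - 1) ^ L := by gcongr
    _ = 4 * k * m ^ 2 * n ^ 2 * (N : ℝ) ^ (m - 1) *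
        ((2 * k - 1) ^ (n - L) * (2 * k - 1) ^ L) := by ring
    _ = 4 * k * m ^ 2 * n ^ 2 * (2 * k - 1) ^ 2 * (N : ℝ) ^ (m - 1) * (2 * k - 1) ^ (n - 2) := by
      rw [e2]; ring
    _ ≤ 4 * k * m ^ 2 * n ^ 2 * (2 * k - 1) ^ 2 * (N : ℝ) ^ (m - 1) * N := by gcongr
    _ = _ := by ring

theorem ratio_trivial {k m : ℕ} (lam : ℝ) (n : ℕ) :
    |((gammaA {T : Fin m → FreeGroup (Fin k) | T ∈ Cset k m ∧
      SmallCancelCond lam (symClosure T)} n : ℝ) / (gammaA (Cset k m) n : ℝ)) - 1| ≤ 1 := by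
  classical
  unfold gammaA
  rw [Cset_level, U_level, Set.ncard_coe_finset, Set.ncard_coe_finset]
  have h := Finset.card_filter_le (Fintype.piFinset fun _ : Fin m => SN k n)
    (fun T => SmallCancelCond lam (symClosure T))
  have h1 := div_le_one_of_le₀ (G₀ := ℝ) (Nat.cast_le.2 h) (Nat.cast_nonneg _)
  have h0 : (0 : ℝ) ≤ (((Fintype.piFinset fun _ : Fin m => SN k n).filter
        fun T => SmallCancelCond lam (symClosure T)).card : ℝ) /
        ((Fintype.piFinset fun _ : Fin m => SN k n).card : ℝ) := by positivity
  rw [abs_le]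
  constructor <;> linarith

theorem statement10 (k m : ℕ) (hk : 2 ≤ k) (hm : 1 ≤ m)
    (lam : ℝ) (hlam0 : 0 < lam) (hlam1 : lam < 1) :
    ExpGenericIn {T : Fin m → FreeGroup (Fin k) | T ∈ Cset k m ∧
      SmallCancelCond lam (symClosure T)} := by

  refine ⟨fun T hT => hT.1, ?_⟩
  obtain ⟨mu, hmu⟩ : ∃ mu : ℝ, mu = min lam (1 / 2) := ⟨_, rfl⟩
  have hmu0 : 0 < mu := by rw [hmu]; exact lt_min hlam0 (by norm_num)
  have hmul : mu ≤ lam := by rw [hmu]; exact min_le_left _ _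
  have hmuh : mu ≤ 1 / 2 := by rw [hmu]; exact min_le_right _ _
  have hkR : (2 : ℝ) ≤ k := by exact_mod_cast hk
  obtain ⟨D, hD⟩ : ∃ D : ℝ, D = 2 * k - 1 := ⟨_, rfl⟩
  have hD1 : 1 < D := by rw [hD]; linarith
  have hD0 : 0 < D := by linarith
  obtain ⟨q, hq⟩ : ∃ q : ℝ, q = D ^ (-(mu / 2)) := ⟨_, rfl⟩
  have hq0 : 0 < q := by rw [hq]; positivity
  have hq1 : q < 1 := by
    rw [hq]
    exact Real.rpow_lt_one_of_one_lt_of_neg hD1 (by linarith)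
  obtain ⟨C2, hC2⟩ : ∃ C2 : ℝ, ∀ n : ℕ, (n : ℝ) ^ 2 * q ^ n ≤ C2 := by
    have ht := tendsto_pow_const_mul_const_pow_of_abs_lt_one 2
      (show |q| < 1 by rw [abs_of_pos hq0]; exact hq1)
    obtain ⟨C2, h⟩ := ht.bddAbove_range
    exact ⟨C2, fun n => h ⟨n, rfl⟩⟩
  have hC20 : 0 ≤ C2 := by simpa using hC2 0
  refine ⟨4 * k * m ^ 2 * D ^ 3 * C2 + 1 / q ^ 2, by positivity, q, hq0, hq1, fun n => ?_⟩
  by_cases hn : n < 2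
  · refine (ratio_trivial lam n).trans ?_
    have h1 : (1 : ℝ) ≤ 1 / q ^ 2 * q ^ n := by
      rw [one_div, inv_mul_eq_div, one_le_div (by positivity)]
      exact pow_le_pow_of_le_one hq0.le hq1.le hn.le
    have h2 : 0 ≤ 4 * k * m ^ 2 * D ^ 3 * C2 * q ^ n := by positivity
    linarith
  · push Not at hn
    have hfl : ((⌊mu * n⌋₊ : ℕ) : ℝ) ≤ mu * n := Nat.floor_le (by positivity)
    have hfl2 : mu * n < (⌊mu * n⌋₊ : ℕ) + 1 := Nat.lt_floor_add_one _
    have hn0 : (0 : ℝ) ≤ n := Nat.cast_nonneg n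
    have hr := ratio_bound (m := m) hk hm lam n ⌊mu * n⌋₊ hn (by
      have : (2 : ℝ) * (⌊mu * n⌋₊ : ℕ) ≤ n := by nlinarith
      exact_mod_cast this) (hfl.trans (by gcongr))
    refine hr.trans ?_
    rw [← hD]
    have hDL : 1 / D ^ ⌊mu * n⌋₊ ≤ D * (q ^ n * q ^ n) := by
      have e : D * (q ^ n * q ^ n) = D ^ (1 - mu * n) := by
        rw [hq, ← Real.rpow_natCast, ← Real.rpow_mul hD0.le, ← Real.rpow_add hD0]
        nth_rewrite 1 [← Real.rpow_one D]
        rw [← Real.rpow_add hD0]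
        congr 1; ring
      rw [e, one_div, ← Real.rpow_natCast, ← Real.rpow_neg hD0.le]
      exact Real.rpow_le_rpow_of_exponent_le hD1.le (by linarith)
    calc 4 * k * m ^ 2 * n ^ 2 * D ^ 2 / D ^ ⌊mu * n⌋₊
        = 4 * k * m ^ 2 * n ^ 2 * D ^ 2 * (1 / D ^ ⌊mu * n⌋₊) := by ring
      _ ≤ 4 * k * m ^ 2 * n ^ 2 * D ^ 2 * (D * (q ^ n * q ^ n)) := by gcongr
      _ = 4 * k * m ^ 2 * D ^ 3 * (n ^ 2 * q ^ n) * q ^ n := by ring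
      _ ≤ 4 * k * m ^ 2 * D ^ 3 * C2 * q ^ n := by gcongr; exact hC2 n
      _ ≤ (4 * k * m ^ 2 * D ^ 3 * C2 + 1 / q ^ 2) * q ^ n := by
        gcongr
        have : 0 < 1 / q ^ 2 := by positivity
        linarith
end

section
/- Let k ≥ 2 and let g be a cyclically reduced primitive element of the free group F(a_1,…,a_k). Then there exists a freely reduced word w of length two in F(a_1,…,a_k) such that neither w nor w^{-1} occurs as a subword of g. -/
/-- `g` is a primitive element of the free group: the image of the first free
generator under some automorphism (equivalently, `g` belongs to a free basis). -/
def IsPrimitive {k : ℕ} (hk : 0 < k) (g : FreeGroup (Fin k)) : Prop :=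
  ∃ φ : FreeGroup (Fin k) ≃* FreeGroup (Fin k), φ (FreeGroup.of ⟨0, hk⟩) = g

open FreeGroup in
theorem aux_invRev_red {α : Type} [DecidableEq α] {L : List (α × Bool)} (h : IsReduced L) :
    IsReduced (invRev L) := by
  rw [isReduced_iff_reduce_eq] at *
  rw [reduce_invRev, h]

open FreeGroup in
theorem aux_invRev_cyc {α : Type} [DecidableEq α] {L : List (α × Bool)}
    (h : IsCyclicallyReduced L) : IsCyclicallyReduced (invRev L) := by
  refine ⟨aux_invRev_red h.1, ?_⟩
  intro a ha b hb hab
  simp only [invRev, List.getLast?_reverse, List.head?_reverse, List.head?_map, List.getLast?_map,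
    Option.mem_def, Option.map_eq_some_iff] at ha hb
  obtain ⟨a', ha', rfl⟩ := ha
  obtain ⟨b', hb', rfl⟩ := hb
  have := h.2 b' hb' a' ha' hab.symm
  simp [this]

open FreeGroup in
/-- Extending a reduced word along the positive half-axis of a cyclically reduced word. -/
theorem aux_axis {α : Type} [DecidableEq α] {G p u t : List (α × Bool)} {y : α × Bool}
    (h : IsCyclicallyReduced G) (hp : IsReduced (p ++ [y])) (hG : G = u ++ [y] ++ t) (m : ℕ) :
    IsReduced (p ++ [y] ++ (t ++ (List.replicate m G).flatten)) := by
  have h1 := (h.flatten_replicate (m + 1)).1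
  refine IsReduced.append_overlap hp ?_ (by simp)
  refine h1.infix ⟨u, [], ?_⟩
  rw [List.replicate_succ, List.flatten_cons]
  conv_rhs => rw [hG]
  simp [hG]

open FreeGroup in
theorem aux_mk_flatten {α : Type} (G : List (α × Bool)) (m : ℕ) :
    mk (List.replicate m G).flatten = (mk G) ^ m := by
  induction m with
  | zero => simp [one_eq_mk]
  | succ m ih => rw [List.replicate_succ, List.flatten_cons, ← mul_mk, ih, pow_succ']

theorem aux_pow_inv {G : Type*} [Group G] (c : G → Prop) (g : G)
    (hg : ∀ f, c (f * g) ↔ c f) (f : G) (m : ℕ) : c (f * g ^ m) ↔ c f := by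
  induction m with
  | zero => simp
  | succ m ih => rw [pow_succ, ← mul_assoc, hg, ih]

open FreeGroup in
/-- The key combinatorial step. -/
theorem aux_step {α : Type} [DecidableEq α] (c : FreeGroup α → Prop) (g : FreeGroup α)
    (hcyc : IsCyclicallyReduced g.toWord) (hg : ∀ f, c (f * g) ↔ c f)
    (p : List (α × Bool)) (x y : α × Bool)
    (hx : IsReduced (p ++ [x])) (hy : IsReduced (p ++ [y]))
    (hs : Subword [(x.1, !x.2), y] g.toWord) (N : ℕ) :
    ∃ q q', IsReduced (p ++ [x] ++ q) ∧ IsReduced (p ++ [y] ++ q') ∧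
      N ≤ (p ++ [x] ++ q).length ∧ N ≤ (p ++ [y] ++ q').length ∧
      (c (mk (p ++ [x] ++ q)) ↔ c (mk (p ++ [y] ++ q'))) := by
  obtain ⟨s, t, hst⟩ := hs
  have hlen : ∀ G : List (α × Bool), 1 ≤ G.length → N ≤ (List.replicate N G).flatten.length := by
    intro G hG
    simp
    nlinarith
  have hG : 1 ≤ g.toWord.length := by rw [hst]; simp; omega
  refine ⟨invRev s ++ (List.replicate N (invRev g.toWord)).flatten,
    t ++ (List.replicate N g.toWord).flatten, ?_, ?_, ?_, ?_, ?_⟩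
  · refine aux_axis (u := invRev t ++ invRev [y]) (aux_invRev_cyc hcyc) hx ?_ N
    rw [hst]; simp [invRev]
  · exact aux_axis (u := s ++ [(x.1, !x.2)]) hcyc hy (by rw [hst]; simp) N
  · have := hlen (invRev g.toWord) (by simpa using hG)
    simp only [List.length_append] at *; omega
  · have := hlen (g.toWord) (by simpa using hG)
    simp only [List.length_append] at *; omega
  · have e1 : mk (p ++ [x] ++ (invRev s ++ (List.replicate N (invRev g.toWord)).flatten))
        = mk p * mk [x] * (mk s)⁻¹ * (g ^ N)⁻¹ := by
      simp only [← mul_mk, aux_mk_flatten, ← inv_mk, mk_toWord, inv_pow, mul_assoc]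
    have e2 : mk (p ++ [y] ++ (t ++ (List.replicate N g.toWord).flatten))
        = mk p * mk [x] * (mk s)⁻¹ * (g ^ N)⁻¹ * g ^ (N + 1 + N) := by
      have hgg : g = mk s * ((mk [x])⁻¹ * mk [y]) * mk t := by
        conv_lhs => rw [← mk_toWord (x := g), hst]
        have e3 : (mk [x])⁻¹ * mk [y] = mk [(x.1, !x.2), y] := rfl
        rw [e3, mul_mk, mul_mk]
      simp only [← mul_mk, aux_mk_flatten, mk_toWord]
      have : g ^ (N + 1 + N) = g ^ N * (g * g ^ N) := by rw [pow_add, pow_succ, mul_assoc]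
      rw [this, ← mul_assoc (_ * (g ^ N)⁻¹), inv_mul_cancel_right]
      generalize g ^ N = z
      rw [hgg]; group
    rw [e1, e2, aux_pow_inv c g hg]

open FreeGroup in
theorem aux_const {α : Type} [DecidableEq α] (c : FreeGroup α → Prop) (g : FreeGroup α)
    (hcyc : IsCyclicallyReduced g.toWord) (hg : ∀ f, c (f * g) ↔ c f)
    (hw : ∀ w : FreeGroup α, w.toWord.length = 2 →
      Subword w.toWord g.toWord ∨ Subword (w⁻¹).toWord g.toWord)
    (N : ℕ)
    (hN : ∀ f : FreeGroup α, N ≤ f.toWord.length → ∀ s : α × Bool, (c (f * mk [s]) ↔ c f))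
    (d : ℕ) : ∀ p : List (α × Bool), p.length + d = N → ∀ q q', IsReduced (p ++ q) →
      IsReduced (p ++ q') → N ≤ (p ++ q).length → N ≤ (p ++ q').length →
      (c (mk (p ++ q)) ↔ c (mk (p ++ q'))) := by
  induction d with
  | zero =>
    intro p hp
    have key : ∀ q, IsReduced (p ++ q) → (c (mk (p ++ q)) ↔ c (mk p)) := by
      intro q
      induction q using List.reverseRecOn with
      | nil => simp
      | append_singleton q s ih =>
        intro hq
        have hq' : IsReduced (p ++ q) := hq.infix ⟨[], [s], by simp⟩
        rw [← ih hq', ← hN (mk (p ++ q)) _ s, mul_mk, List.append_assoc]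
        rw [toWord_mk, hq'.reduce_eq]; simp; omega
    intro q q' hq hq' _ _
    rw [key q hq, key q' hq']
  | succ d ih =>
    intro p hp q q' hq hq' hl hl'
    obtain _ | ⟨x, q⟩ := q
    · simp at hl; omega
    obtain _ | ⟨y, q'⟩ := q'
    · simp at hl'; omega
    have r : ∀ (x : α × Bool) q, p ++ x :: q = p ++ [x] ++ q := by simp
    rw [r x q] at hq hl ⊢
    rw [r y q'] at hq' hl' ⊢
    by_cases hxy : x = y
    · subst hxy
      exact ih _ (by simp; omega) _ _ hq hq' hl hl'
    have hx : IsReduced (p ++ [x]) := hq.infix ⟨[], q, by simp⟩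
    have hy : IsReduced (p ++ [y]) := hq'.infix ⟨[], q', by simp⟩
    have hred : IsReduced [(x.1, !x.2), y] := by
      obtain ⟨x1, x2⟩ := x
      obtain ⟨y1, y2⟩ := y
      simp [FreeGroup.IsReduced] at hxy ⊢
      intro h
      have := hxy h
      cases x2 <;> cases y2 <;> simp_all
    have hwd : (mk [(x.1, !x.2), y]).toWord = [(x.1, !x.2), y] := by
      rw [toWord_mk, hred.reduce_eq]
    rcases hw (mk [(x.1, !x.2), y]) (by rw [hwd]; rfl) with h | h
    · rw [hwd] at h
      obtain ⟨r1, r2, h1, h2, h3, h4, h5⟩ := aux_step c g hcyc hg p x y hx hy h N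
      rw [ih (p ++ [x]) (by simp; omega) q r1 hq h1 hl h3,
        ih (p ++ [y]) (by simp; omega) q' r2 hq' h2 hl' h4, h5]
    · rw [toWord_inv, hwd] at h
      have h : Subword [(y.1, !y.2), x] g.toWord := by simpa [invRev] using h
      obtain ⟨r1, r2, h1, h2, h3, h4, h5⟩ := aux_step c g hcyc hg p y x hy hx h N
      rw [ih (p ++ [x]) (by simp; omega) q r2 hq h2 hl h4,
        ih (p ++ [y]) (by simp; omega) q' r1 hq' h1 hl' h3, h5]

open FreeGroup in
/-- First letter of `f * a_i` versus `f`. -/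
theorem aux_head {α : Type} [DecidableEq α] (j i : α) (f : FreeGroup α) (h : i = j → f ≠ 1) :
    (f * of i).toWord.head? = some (j, true) ↔ f.toWord.head? = some (j, true) := by
  rcases List.eq_nil_or_concat f.toWord with h0 | ⟨M, z, hM⟩
  · rw [toWord_eq_nil_iff] at h0
    subst h0
    simp at h
    simp [h]
  · rw [List.concat_eq_append] at hM
    have hr : IsReduced (M ++ [z]) := hM ▸ isReduced_toWord
    have hf : f = mk M * mk [z] := by rw [mul_mk, ← hM, mk_toWord]
    by_cases hz : z = (i, false)
    · subst hz
      have : f * of i = mk M := by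
        rw [hf, mul_assoc]
        have : (mk [(i, false)] : FreeGroup α) = (of i)⁻¹ := rfl
        rw [this]; simp
      have hMr : IsReduced M := hr.infix ⟨[], _, rfl⟩
      rw [this, toWord_mk, hMr.reduce_eq, hM]
      cases M <;> simp
    · have hr2 : IsReduced (M ++ [z] ++ [(i, true)]) := by
        refine IsReduced.append_overlap hr ?_ (by simp)
        obtain ⟨z1, z2⟩ := z
        simp [FreeGroup.IsReduced] at hz ⊢
        exact hz
      rw [toWord_mul, hM, toWord_of, hr2.reduce_eq]
      cases M <;> simp

open FreeGroup in
theorem aux_finite {α : Type} [DecidableEq α] (j : α) (h : FreeGroup α) :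
    {f : FreeGroup α | ¬ ((f * h).toWord.head? = some (j, true) ↔
      f.toWord.head? = some (j, true))}.Finite := by
  induction h using FreeGroup.induction_on with
  | C1 => simp
  | of i =>
    refine (Set.finite_singleton 1).subset ?_
    intro f hf
    by_contra h1
    exact hf (aux_head j i f (fun _ => h1))
  | inv_of i ih =>
    refine (ih.image (fun f => f * of i)).subset ?_
    intro f hf
    refine ⟨f * (of i)⁻¹, ?_, by simp⟩
    simp only [Set.mem_ofPred_eq, inv_mul_cancel_right] at hf ⊢
    tauto
  | mul x y hx hy =>
    refine (hx.union (hy.image (fun f => f * x⁻¹))).subset ?_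
    intro f hf
    by_cases h1 : ((f * x).toWord.head? = some (j, true) ↔ f.toWord.head? = some (j, true))
    · right
      refine ⟨f * x, ?_, by simp⟩
      simp only [Set.mem_ofPred_eq, ← mul_assoc] at hf ⊢
      rwa [h1]
    · left; exact h1

open FreeGroup in
theorem statement17 (k : ℕ) (hk : 2 ≤ k) (g : FreeGroup (Fin k))
    (hcyc : CyclicallyReduced g)
    (hprim : IsPrimitive (by omega) g) :
    ∃ w : FreeGroup (Fin k), w.toWord.length = 2 ∧
      ¬ Subword w.toWord g.toWord ∧ ¬ Subword (w⁻¹).toWord g.toWord := by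
  by_contra hcon
  have hw : ∀ w : FreeGroup (Fin k), w.toWord.length = 2 →
      Subword w.toWord g.toWord ∨ Subword (w⁻¹).toWord g.toWord := by
    intro w hwl
    by_contra h
    exact hcon ⟨w, hwl, by tauto⟩
  obtain ⟨φ, hφ⟩ := hprim
  have hc : IsCyclicallyReduced g.toWord := by
    refine ⟨isReduced_toWord, ?_⟩
    intro a ha b hb hab
    have := hcyc b a hb ha
    by_contra h2
    apply this
    ext
    · simp [hab]
    · revert h2
      cases a.2 <;> cases b.2 <;> simp
  let i0 : Fin k := ⟨0, by omega⟩
  let j : Fin k := ⟨1, by omega⟩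
  have hij : i0 ≠ j := by simp [i0, j]
  let c : FreeGroup (Fin k) → Prop := fun f => (φ.symm f).toWord.head? = some (j, true)
  have hg : ∀ f, c (f * g) ↔ c f := by
    intro f
    have : φ.symm g = of i0 := by rw [← hφ]; simp [i0]
    have e : φ.symm (f * g) = φ.symm f * of i0 := by rw [_root_.map_mul, this]
    change (φ.symm (f * g)).toWord.head? = _ ↔ _
    rw [e]
    exact aux_head j i0 _ (fun h => absurd h hij)
  have hfin : ∀ h, {f | ¬ (c (f * h) ↔ c f)}.Finite := by
    intro h
    have := (aux_finite j (φ.symm h)).preimage (φ.symm.injective.injOn)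
    simpa [c, Set.preimage] using this
  have hfin2 : (⋃ s : Fin k × Bool, {f | ¬ (c (f * mk [s]) ↔ c f)}).Finite :=
    Set.finite_iUnion (fun s => hfin _)
  obtain ⟨B, hB⟩ := (hfin2.image (fun f => f.toWord.length)).bddAbove
  have hN : ∀ f : FreeGroup (Fin k), B + 1 ≤ f.toWord.length →
      ∀ s : Fin k × Bool, (c (f * mk [s]) ↔ c f) := by
    intro f hf s
    by_contra h
    have := hB ⟨f, Set.mem_iUnion.2 ⟨s, h⟩, rfl⟩
    simp only at this
    omega
  have hconst := aux_const c g hc hg hw (B + 1) hN (B + 1) [] (by simp)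
  have hball : {f : FreeGroup (Fin k) | f.toWord.length < B + 1}.Finite :=
    (List.finite_length_lt (Fin k × Bool) (B + 1)).preimage toWord_injective.injOn
  have hex : ∀ i : Fin k, ∃ n : ℕ, B + 1 ≤ (φ (of i ^ (n + 1))).toWord.length := by
    intro i
    have hinj : Function.Injective (fun n : ℕ => φ (of i ^ (n + 1))) := by
      intro a b hab
      have h1 := congrArg (fun f => f.toWord.length) (φ.injective hab)
      simpa only [toWord_of_pow, List.length_replicate, Nat.add_right_cancel_iff] using h1
    obtain ⟨_, ⟨n, rfl⟩, hn⟩ := (Set.infinite_range_of_injective hinj).exists_notMem_finite hball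
    exact ⟨n, by simpa using hn⟩
  obtain ⟨n, hn⟩ := hex j
  obtain ⟨m, hm⟩ := hex i0
  have := hconst (φ (of j ^ (n + 1))).toWord (φ (of i0 ^ (m + 1))).toWord (isReduced_toWord (x := φ (of j ^ (n + 1))))
    (isReduced_toWord (x := φ (of i0 ^ (m + 1)))) hn hm
  rw [List.nil_append, List.nil_append, mk_toWord, mk_toWord] at this
  have hcv : ∀ (i : Fin k) (n : ℕ), c (φ (of i ^ (n + 1))) ↔ i = j := by
    intro i n
    change (φ.symm (φ (of i ^ (n + 1)))).toWord.head? = _ ↔ _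
    rw [MulEquiv.symm_apply_apply, toWord_of_pow, List.replicate_succ, List.head?_cons]
    simp
  rw [hcv, hcv] at this
  exact hij (this.1 rfl)
end
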